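/- Let X and Y be nonempty sets. If |X| ≠ |Y|, or X is infinite, or Y is infinite, then there exists a mapping f : X → Y such that c(f) ≠ d(f), where c(f) = |X \ T_f| for a transversal T_f of ker(f) and d(f) = |Y \ Xf|. -/

import Mathlib

open Function Set

/-- `c : I → I` is the character of `f` w.r.t. the partition of `X` whose blocks are
the fibers of `idx : X → I`: the block `X_i = idx⁻¹{i}` is mapped by `f` into `X_{c i}`. -/
def IsChar {X I : Type*} (idx : X → I) (f : X → X) (c : I → I) : Prop :=
  ∀ x, c (idx x) = idx (f x)

/-- `f` preserves the partition, i.e. `f ∈ T(X,P)`. -/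
def PresP {X I : Type*} (idx : X → I) (f : X → X) : Prop :=
  ∃ c, IsChar idx f c

/-- `f ∈ T_{S(I)}(X,P)`: the character of `f` lies in `S`. -/
def InTS {X I : Type*} (idx : X → I) (S : Set (I → I)) (f : X → X) : Prop :=
  ∃ c ∈ S, IsChar idx f c

/-- `α` is a unit of the (sub)monoid `S` of `T(I)`. -/
def IsUnitS {I : Type*} (S : Set (I → I)) (α : I → I) : Prop :=
  α ∈ S ∧ ∃ β ∈ S, (∀ i, β (α i) = i) ∧ (∀ i, α (β i) = i)

/-- `u` is a unit of the monoid `T_{S(I)}(X,P)`. -/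
def IsUnitTS {X I : Type*} (idx : X → I) (S : Set (I → I)) (u : X → X) : Prop :=
  InTS idx S u ∧ ∃ v, InTS idx S v ∧ (∀ x, v (u x) = x) ∧ (∀ x, u (v x) = x)
universe u

theorem exists_collapse_ne_defect_of_injective_not_surjective {X Y : Type u} {f : X → Y}
    (hf : Injective f) (hs : ¬ Surjective f) :
    ∃ f : X → Y, ∃ T : Set X,
      (∀ x : X, ∃! t, t ∈ T ∧ f t = f x) ∧
      Cardinal.mk ↥(Tᶜ) ≠ Cardinal.mk ↥((Set.range f)ᶜ) := by
  refine ⟨f, univ, fun x => ⟨x, ⟨mem_univ x, rfl⟩, fun t ht => hf ht.2⟩, fun h => hs ?_⟩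
  rw [compl_univ, Cardinal.mk_eq_zero, eq_comm, Cardinal.mk_set_eq_zero_iff,
    compl_empty_iff] at h
  exact range_eq_univ.mp h

theorem exists_collapse_ne_defect_of_mk_lt {X Y : Type u} [Nonempty Y]
    (h : Cardinal.mk Y < Cardinal.mk X) :
    ∃ f : X → Y, ∃ T : Set X,
      (∀ x : X, ∃! t, t ∈ T ∧ f t = f x) ∧
      Cardinal.mk ↥(Tᶜ) ≠ Cardinal.mk ↥((Set.range f)ᶜ) := by
  obtain ⟨g⟩ := h.le
  have hl : LeftInverse (invFun g) g := leftInverse_invFun g.injective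
  refine ⟨invFun g, range g, fun x => ⟨g (invFun g x), ⟨mem_range_self _, hl _⟩, ?_⟩,
    fun hc => h.not_ge ?_⟩
  · rintro _ ⟨⟨y, rfl⟩, hy⟩
    rw [← hy, hl]
  · rw [hl.surjective.range_eq, compl_univ, Cardinal.mk_eq_zero (∅ : Set Y),
      Cardinal.mk_set_eq_zero_iff, compl_empty_iff] at hc
    exact Cardinal.mk_le_of_surjective (range_eq_univ.mp hc)

theorem exists_map_collapse_ne_defect {X Y : Type u} [Nonempty X] [Nonempty Y]
    (h : Cardinal.mk X ≠ Cardinal.mk Y ∨ Infinite X ∨ Infinite Y) :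
    ∃ f : X → Y, ∃ T : Set X,
      (∀ x : X, ∃! t, t ∈ T ∧ f t = f x) ∧
      Cardinal.mk ↥(Tᶜ) ≠ Cardinal.mk ↥((Set.range f)ᶜ) := by
  rcases lt_or_ge (Cardinal.mk Y) (Cardinal.mk X) with hlt | ⟨⟨f, hf⟩⟩
  · exact exists_collapse_ne_defect_of_mk_lt hlt
  by_cases hs : Surjective f
  · let e := Equiv.ofBijective f ⟨hf, hs⟩
    have : Infinite X := by
      rcases h with h | h | h
      · exact absurd (Cardinal.mk_congr e) h
      · exact h
      · exact Infinite.of_injective e.symm e.symm.injective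
    obtain ⟨o⟩ : Nonempty (Option X ≃ Y) := by
      rw [← Cardinal.eq, Cardinal.mk_option, Cardinal.add_one_eq (Cardinal.aleph0_le_mk X)]
      exact Cardinal.mk_congr e
    refine exists_collapse_ne_defect_of_injective_not_surjective
      (f := fun x => o (some x)) (o.injective.comp (Option.some_injective X)) fun hsurj => ?_
    obtain ⟨x, hx⟩ := hsurj (o none)
    exact Option.some_ne_none x (o.injective hx)
  · exact exists_collapse_ne_defect_of_injective_not_surjective hf hs
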